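/- (Birkhoff theorem for exponential averages) Let (X,μ) be a probability space, T measure-preserving, f ∈ L¹_μ(X,ℝ^l). Then h(x) := lim_{λ→1⁻} (1−λ) ∑_{j≥0} λ^j f(T^j x) exists μ-a.e., h is T-invariant μ-a.e., h ∈ L¹_μ, ∫_𝒜 f dμ = ∫_𝒜 h dμ for every T-invariant Borel set 𝒜, and the convergence holds in L¹_μ. -/

import Mathlib

open scoped Topology
open Filter MeasureTheory

section AbelMean

variable {X E : Type*} [NormedAddCommGroup E] [NormedSpace ℝ E]

/-- The Abel sum `∑ λ ^ j • f (T^[j] x)` of `f` along the orbit of `x`. -/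
noncomputable def abelSum (T : X → X) (f : X → E) (lam : ℝ) (x : X) : E :=
  ∑' j : ℕ, lam ^ j • f (T^[j] x)

/-- The terms of the Abel sum of `f` at `x` are absolutely summable for all `λ ∈ [0, 1)`. -/
def AbelSummable (T : X → X) (f : X → E) (x : X) : Prop :=
  ∀ lam : ℝ, 0 ≤ lam → lam < 1 → Summable fun j : ℕ => ‖lam ^ j • f (T^[j] x)‖

/-- Rates increasing to `1`. -/
noncomputable def abelRate (n : ℕ) : ℝ := 1 - ((n : ℝ) + 2)⁻¹

lemma half_le_abelRate (n : ℕ) : 1 / 2 ≤ abelRate n := by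
  have : ((n : ℝ) + 2)⁻¹ ≤ 2⁻¹ := by gcongr; linarith [n.cast_nonneg (α := ℝ)]
  unfold abelRate; linarith

lemma abelRate_nonneg (n : ℕ) : 0 ≤ abelRate n := by linarith [half_le_abelRate n]

lemma abelRate_lt_one (n : ℕ) : abelRate n < 1 := by
  have : 0 < ((n : ℝ) + 2)⁻¹ := by positivity
  unfold abelRate; linarith

lemma tendsto_one_sub_abelRate : Tendsto (fun n => 1 - abelRate n) atTop (𝓝 0) := by
  have : Tendsto (fun n : ℕ => ((n : ℝ) + 2)⁻¹) atTop (𝓝 0) :=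
    tendsto_inv_atTop_zero.comp (tendsto_atTop_add_const_right _ _ tendsto_natCast_atTop_atTop)
  simpa [abelRate] using this

lemma exists_lt_abelRate {lam : ℝ} (h : lam < 1) : ∃ n, lam < abelRate n := by
  obtain ⟨n, hn⟩ := (tendsto_one_sub_abelRate.eventually_lt_const (sub_pos.2 h)).exists
  exact ⟨n, by linarith⟩

lemma abelSum_eq_add [CompleteSpace E] {T : X → X} {f : X → E} {x : X} {lam : ℝ}
    (hs : Summable fun j : ℕ => ‖lam ^ j • f (T^[j] x)‖) :
    abelSum T f lam x = f x + lam • abelSum T f lam (T x) := by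
  unfold abelSum
  rw [hs.of_norm.tsum_eq_zero_add, ← tsum_const_smul'']
  simp [pow_succ', mul_smul]

lemma AbelSummable.comp {F : Type*} [NormedAddCommGroup F] [NormedSpace ℝ F]
    {T : X → X} {f : X → E} {x : X} (hs : AbelSummable T f x) (L : E →L[ℝ] F) :
    AbelSummable T (fun y => L (f y)) x := fun lam h0 h1 =>
  .of_nonneg_of_le (fun _ => norm_nonneg _)
    (fun j => by rw [← map_smul]; exact L.le_opNorm _) ((hs lam h0 h1).mul_left ‖L‖)

lemma AbelSummable.abelSum_comp [CompleteSpace E] {F : Type*} [NormedAddCommGroup F]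
    [NormedSpace ℝ F] {T : X → X} {f : X → E} {x : X} (hs : AbelSummable T f x)
    (L : E →L[ℝ] F) {lam : ℝ} (h0 : 0 ≤ lam) (h1 : lam < 1) :
    abelSum T (fun y => L (f y)) lam x = L (abelSum T f lam x) := by
  unfold abelSum
  rw [L.map_tsum (hs lam h0 h1).of_norm]
  simp

lemma AbelSummable.abelSum_add [CompleteSpace E] {T : X → X} {f g : X → E} {x : X}
    (hf : AbelSummable T f x) (hg : AbelSummable T g x) {lam : ℝ} (h0 : 0 ≤ lam) (h1 : lam < 1) :
    abelSum T (fun y => f y + g y) lam x = abelSum T f lam x + abelSum T g lam x := by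
  unfold abelSum
  rw [← (hf lam h0 h1).of_norm.tsum_add (hg lam h0 h1).of_norm]
  simp

lemma AbelSummable.abelSum_sub_const {T : X → X} {f : X → ℝ} {g : X → ℝ} {x : X}
    (hf : AbelSummable T f x) (hg : ∀ y, g (T y) = g y)
    {lam : ℝ} (h0 : 0 ≤ lam) (h1 : lam < 1) :
    abelSum T (fun y => f y - g y) lam x = abelSum T f lam x - (1 - lam)⁻¹ * g x := by
  have hgj (j : ℕ) : g (T^[j] x) = g x := by
    induction j with
    | zero => rfl
    | succ j ih => rw [Function.iterate_succ_apply', hg, ih]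
  unfold abelSum
  simp only [hgj, smul_eq_mul, mul_sub]
  have hf' := (hf lam h0 h1).of_norm
  simp only [smul_eq_mul] at hf'
  rw [hf'.tsum_sub ((summable_geometric_of_lt_one h0 h1).mul_right _), tsum_mul_right,
    tsum_geometric_of_lt_one h0 h1]

lemma abelSum_nonneg {T : X → X} {f : X → ℝ} (hf0 : ∀ x, 0 ≤ f x) {lam : ℝ} (h0 : 0 ≤ lam)
    (x : X) : 0 ≤ abelSum T f lam x :=
  tsum_nonneg fun j => mul_nonneg (pow_nonneg h0 j) (hf0 _)

lemma AbelSummable.abelSum_mono {T : X → X} {f : X → ℝ} (hf0 : ∀ x, 0 ≤ f x) {x : X}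
    (hx : AbelSummable T f x) {r s : ℝ} (hr : 0 ≤ r) (hrs : r ≤ s) (hs : s < 1) :
    abelSum T f r x ≤ abelSum T f s x :=
  Summable.tsum_le_tsum (fun j => mul_le_mul_of_nonneg_right (pow_le_pow_left₀ hr hrs j) (hf0 _))
    (hx r hr (hrs.trans_lt hs)).of_norm (hx s (hr.trans hrs) hs).of_norm

lemma eventually_mem_Ico_nhdsLT_one : ∀ᶠ lam in 𝓝[<] (1 : ℝ), 0 ≤ lam ∧ lam < 1 :=
  Ico_mem_nhdsLT one_pos

/-- For nonnegative functions, convergence of the Abel means along `abelRate` implies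
convergence as `λ → 1⁻`. -/
lemma AbelSummable.tendsto_abelMean {T : X → X} {f : X → ℝ} (hf0 : ∀ x, 0 ≤ f x) {x : X}
    (hx : AbelSummable T f x) {a : ℝ}
    (h : Tendsto (fun n => (1 - abelRate n) * abelSum T f (abelRate n) x) atTop (𝓝 a)) :
    Tendsto (fun lam : ℝ => (1 - lam) * abelSum T f lam x) (𝓝[<] 1) (𝓝 a) := by
  set b : ℕ → ℝ := fun n => (n : ℝ)⁻¹ * abelSum T f (1 - (n : ℝ)⁻¹) x with hb
  have hbt : Tendsto b atTop (𝓝 a) := by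
    rw [← tendsto_add_atTop_iff_nat 2]
    refine h.congr fun n => ?_
    simp [hb, abelRate]
  have ht : Tendsto (fun lam : ℝ => (1 - lam)⁻¹) (𝓝[<] 1) atTop := by
    refine tendsto_inv_nhdsGT_zero.comp ?_
    refine tendsto_nhdsWithin_iff.2 ⟨?_, ?_⟩
    · have : Tendsto (fun lam : ℝ => 1 - lam) (𝓝 1) (𝓝 (1 - 1)) :=
        tendsto_const_nhds.sub tendsto_id
      rw [sub_self] at this
      exact this.mono_left nhdsWithin_le_nhds
    · filter_upwards [self_mem_nhdsWithin] with lam hlam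
      exact sub_pos.2 (Set.mem_Iio.1 hlam)
  have hfl := tendsto_nat_floor_atTop (α := ℝ).comp ht
  have hq : Tendsto (fun lam : ℝ => (⌊(1 - lam)⁻¹⌋₊ : ℝ) / (1 - lam)⁻¹) (𝓝[<] 1) (𝓝 1) :=
    (tendsto_nat_floor_div_atTop (R := ℝ)).comp ht
  have hq' : Tendsto (fun lam : ℝ => ((⌊(1 - lam)⁻¹⌋₊ + 1 : ℕ) : ℝ) / (1 - lam)⁻¹)
      (𝓝[<] 1) (𝓝 1) := by
    have := hq.add (tendsto_inv_atTop_zero.comp ht)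
    rw [add_zero] at this
    refine this.congr fun lam => ?_
    simp only [Function.comp_apply]
    push_cast
    rw [add_div, one_div]
  have hlow := hq.mul (hbt.comp hfl)
  have hupp := hq'.mul (hbt.comp (tendsto_atTop_mono (fun lam => Nat.le_succ _) hfl))
  rw [one_mul] at hlow hupp
  refine tendsto_of_tendsto_of_tendsto_of_le_of_le' hlow hupp ?_ ?_
  · filter_upwards [eventually_mem_Ico_nhdsLT_one, ht.eventually_ge_atTop 1] with lam hlam h1
    have hpos : 0 < 1 - lam := sub_pos.2 hlam.2
    have hn : 1 ≤ ⌊(1 - lam)⁻¹⌋₊ := (Nat.one_le_floor_iff _).2 h1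
    have hn1 : (1 : ℝ) ≤ ⌊(1 - lam)⁻¹⌋₊ := by exact_mod_cast hn
    have hle : (⌊(1 - lam)⁻¹⌋₊ : ℝ) ≤ (1 - lam)⁻¹ := Nat.floor_le (by positivity)
    have hle' : 1 - lam ≤ (⌊(1 - lam)⁻¹⌋₊ : ℝ)⁻¹ := by
      exact (le_inv_comm₀ (by linarith) hpos).1 hle
    simp only [hb, Function.comp_apply]
    rw [div_inv_eq_mul, mul_comm (_ : ℝ) (1 - lam), mul_assoc,
      mul_inv_cancel_left₀ (by positivity)]
    refine mul_le_mul_of_nonneg_left (hx.abelSum_mono hf0 ?_ (by linarith) hlam.2) hpos.le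
    exact sub_nonneg.2 (inv_le_one_of_one_le₀ hn1)
  · filter_upwards [eventually_mem_Ico_nhdsLT_one] with lam hlam
    have hpos : 0 < 1 - lam := sub_pos.2 hlam.2
    have hle : (1 - lam)⁻¹ ≤ ((⌊(1 - lam)⁻¹⌋₊ + 1 : ℕ) : ℝ) := by
      push_cast; exact (Nat.lt_floor_add_one _).le
    have hle' : ((⌊(1 - lam)⁻¹⌋₊ + 1 : ℕ) : ℝ)⁻¹ ≤ 1 - lam := inv_le_of_inv_le₀ hpos hle
    have hp : 0 < ((⌊(1 - lam)⁻¹⌋₊ + 1 : ℕ) : ℝ)⁻¹ := by positivity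
    simp only [hb, Function.comp_apply, Nat.succ_eq_add_one]
    rw [div_inv_eq_mul, mul_comm (_ : ℝ) (1 - lam), mul_assoc,
      mul_inv_cancel_left₀ (by positivity)]
    exact mul_le_mul_of_nonneg_left (hx.abelSum_mono hf0 hlam.1 (by linarith) (by linarith))
      hpos.le

variable [MeasurableSpace X] {μ : Measure X} {T : X → X}

lemma integrable_comp_iterate {F : Type*} [NormedAddCommGroup F] {f : X → F} (hT : MeasurePreserving T μ μ) (hf : Integrable f μ)
    (j : ℕ) : Integrable (fun x => f (T^[j] x)) μ :=
  (hT.iterate j).integrable_comp_of_integrable hf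

lemma integral_comp_iterate {f : X → E} (hT : MeasurePreserving T μ μ) (hf : Integrable f μ)
    (j : ℕ) : ∫ x, f (T^[j] x) ∂μ = ∫ x, f x ∂μ := by
  have h := hT.iterate j
  conv_rhs => rw [← h.map_eq]
  rw [integral_map h.aemeasurable (by rw [h.map_eq]; exact hf.1)]

lemma integral_norm_abel_term {f : X → E} (hT : MeasurePreserving T μ μ) (hf : Integrable f μ)
    {lam : ℝ} (h0 : 0 ≤ lam) (j : ℕ) :
    ∫ x, ‖lam ^ j • f (T^[j] x)‖ ∂μ = lam ^ j * ∫ x, ‖f x‖ ∂μ := by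
  simp only [norm_smul, norm_pow, Real.norm_of_nonneg h0]
  rw [integral_const_mul, integral_comp_iterate hT hf.norm]

lemma lintegral_tsum_abel_ne_top {f : X → E} (hT : MeasurePreserving T μ μ) (hf : Integrable f μ)
    {lam : ℝ} (h0 : 0 ≤ lam) (h1 : lam < 1) :
    ∑' j : ℕ, ∫⁻ x, ‖lam ^ j • f (T^[j] x)‖ₑ ∂μ ≠ ⊤ := by
  have (j : ℕ) : ∫⁻ x, ‖lam ^ j • f (T^[j] x)‖ₑ ∂μ
      = ENNReal.ofReal (lam ^ j * ∫ x, ‖f x‖ ∂μ) := by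
    rw [← integral_norm_abel_term hT hf h0, ofReal_integral_norm_eq_lintegral_enorm]
    exact (integrable_comp_iterate hT hf j).smul _
  simp only [this]
  have hs : Summable fun j : ℕ => lam ^ j * ∫ x, ‖f x‖ ∂μ :=
    (summable_geometric_of_lt_one h0 h1).mul_right _
  exact hs.tsum_ofReal_ne_top

lemma ae_abelSummable {f : X → E} (hT : MeasurePreserving T μ μ) (hf : Integrable f μ) :
    ∀ᵐ x ∂μ, AbelSummable T f x := by
  have H (n : ℕ) : ∀ᵐ x ∂μ, Summable fun j : ℕ => ‖abelRate n ^ j • f (T^[j] x)‖ := by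
    refine summable_norm_of_tsum_eLpNorm_ne_top le_rfl
      (fun j => ((integrable_comp_iterate hT hf j).smul _).1) ?_
    simpa only [eLpNorm_one_eq_lintegral_enorm] using
      lintegral_tsum_abel_ne_top hT hf (abelRate_nonneg n) (abelRate_lt_one n)
  filter_upwards [ae_all_iff.2 H] with x hx lam h0 h1
  obtain ⟨n, hn⟩ := exists_lt_abelRate h1
  refine (hx n).of_nonneg_of_le (fun _ => norm_nonneg _) fun j => ?_
  rw [norm_smul, norm_smul, norm_pow, norm_pow, Real.norm_of_nonneg h0,
    Real.norm_of_nonneg (abelRate_nonneg n)]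
  gcongr

lemma integrable_abelSum [CompleteSpace E] {f : X → E} (hT : MeasurePreserving T μ μ)
    (hf : Integrable f μ) {lam : ℝ} (h0 : 0 ≤ lam) (h1 : lam < 1) :
    Integrable (abelSum T f lam) μ := by
  have hm (j : ℕ) : AEStronglyMeasurable (fun x => lam ^ j • f (T^[j] x)) μ :=
    ((integrable_comp_iterate hT hf j).smul _).1
  have hs := ae_abelSummable hT hf
  refine ⟨aestronglyMeasurable_of_tendsto_ae atTop
    (f := fun n x => ∑ j ∈ Finset.range n, lam ^ j • f (T^[j] x))
    (fun n => Finset.aestronglyMeasurable_fun_sum _ fun j _ => hm j) ?_, ?_⟩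
  · filter_upwards [hs] with x hx using (hx lam h0 h1).of_norm.hasSum.tendsto_sum_nat
  · refine lt_of_le_of_lt (lintegral_mono fun x => enorm_tsum_le_tsum_enorm) ?_
    rw [lintegral_tsum fun j => (hm j).enorm]
    exact (lintegral_tsum_abel_ne_top hT hf h0 h1).lt_top

lemma integral_abelSum {f : X → ℝ} (hT : MeasurePreserving T μ μ)
    (hf : Integrable f μ) {lam : ℝ} (h0 : 0 ≤ lam) (h1 : lam < 1) :
    ∫ x, abelSum T f lam x ∂μ = (1 - lam)⁻¹ * ∫ x, f x ∂μ := by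
  unfold abelSum
  rw [integral_tsum (f := fun j x => lam ^ j • f (T^[j] x))
    (fun j => ((integrable_comp_iterate hT hf j).smul (lam ^ j)).1)
    (lintegral_tsum_abel_ne_top hT hf h0 h1)]
  simp only [smul_eq_mul, integral_const_mul, integral_comp_iterate hT hf]
  rw [tsum_mul_right, tsum_geometric_of_lt_one h0 h1]

/-- Maximal inequality for finitely many Abel sums. -/
lemma setIntegral_nonneg_of_abelSum_pos {g : X → ℝ} (hT : MeasurePreserving T μ μ)
    (hg : Integrable g μ) (s : Finset ℕ) :
    0 ≤ ∫ x in {x | ∃ n ∈ s, 0 < abelSum T g (abelRate n) x}, g x ∂μ := by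
  have hu (n : ℕ) : Integrable (abelSum T g (abelRate n)) μ :=
    integrable_abelSum hT hg (abelRate_nonneg n) (abelRate_lt_one n)
  obtain ⟨M, hM, hM0, hMle, hMeq⟩ : ∃ M : X → ℝ, Integrable M μ ∧ (∀ x, 0 ≤ M x) ∧
      (∀ n ∈ s, ∀ x, abelSum T g (abelRate n) x ≤ M x) ∧
      ∀ x, M x = 0 ∨ ∃ n ∈ s, M x = abelSum T g (abelRate n) x := by
    induction s using Finset.induction_on with
    | empty => exact ⟨0, integrable_zero _ _ _, by simp⟩
    | insert a s _ ih =>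
      obtain ⟨M, hM, hM0, hMle, hMeq⟩ := ih
      refine ⟨fun x => max (abelSum T g (abelRate a) x) (M x), (hu a).sup hM,
        fun x => le_max_of_le_right (hM0 x), fun n hn x => ?_, fun x => ?_⟩
      · rcases Finset.mem_insert.1 hn with rfl | hn
        · exact le_max_left _ _
        · exact le_max_of_le_right (hMle n hn x)
      · rcases max_choice (abelSum T g (abelRate a) x) (M x) with h | h
        · exact Or.inr ⟨a, Finset.mem_insert_self _ _, h⟩
        · rcases hMeq x with h' | ⟨n, hn, h'⟩
          · exact Or.inl (h.trans h')
          · exact Or.inr ⟨n, Finset.mem_insert_of_mem hn, h.trans h'⟩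
  set P := {x | ∃ n ∈ s, 0 < abelSum T g (abelRate n) x} with hP
  have hPM : P = {x | 0 < M x} := by
    ext x
    refine ⟨fun ⟨n, hn, h⟩ => h.trans_le (hMle n hn x), fun h => ?_⟩
    rcases hMeq x with h' | ⟨n, hn, h'⟩
    · exact absurd h' (ne_of_gt h)
    · exact ⟨n, hn, h' ▸ h⟩
  have hPm : NullMeasurableSet P μ := by
    rw [hPM]; exact nullMeasurableSet_lt aemeasurable_const hM.1.aemeasurable
  have hMT : Integrable (fun x => M (T x)) μ := hT.integrable_comp_of_integrable hM
  rw [← integral_indicator₀ hPm]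
  calc (0 : ℝ) = ∫ x, (M x - M (T x)) ∂μ := by
        rw [integral_sub hM hMT]
        exact (sub_eq_zero.2 (integral_comp_iterate hT hM 1).symm).symm
    _ ≤ ∫ x, P.indicator g x ∂μ := by
        refine integral_mono_ae (hM.sub hMT) (hg.indicator₀ hPm) ?_
        filter_upwards [ae_abelSummable hT hg] with x hx
        by_cases hxP : x ∈ P
        · rw [Set.indicator_of_mem hxP]
          have hpos : 0 < M x := by rw [hPM] at hxP; exact hxP
          rcases hMeq x with h' | ⟨n, hn, h'⟩
          · exact absurd h' hpos.ne'
          · rw [h', abelSum_eq_add (hx _ (abelRate_nonneg n) (abelRate_lt_one n))]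
            have h1 := mul_le_mul_of_nonneg_left (hMle n hn (T x)) (abelRate_nonneg n)
            have h2 := mul_le_mul_of_nonneg_right (abelRate_lt_one n).le (hM0 (T x))
            rw [smul_eq_mul]
            linarith
        · rw [Set.indicator_of_notMem hxP]
          have : M x = 0 := le_antisymm (by rw [hPM] at hxP; exact not_lt.1 hxP) (hM0 x)
          linarith [hM0 (T x)]

/-- A function some Abel sum of which is positive almost everywhere has nonnegative integral. -/
lemma integral_nonneg_of_ae_exists_abelSum_pos {g : X → ℝ} (hT : MeasurePreserving T μ μ)
    (hg : Integrable g μ) (h : ∀ᵐ x ∂μ, ∃ n, 0 < abelSum T g (abelRate n) x) :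
    0 ≤ ∫ x, g x ∂μ := by
  set s : ℕ → Set X := fun N => {x | ∃ n ∈ Finset.range N, 0 < abelSum T g (abelRate n) x} with hs
  have hU : (⋃ N, s N) =ᵐ[μ] Set.univ := by
    rw [ae_eq_univ, ← mem_ae_iff]
    filter_upwards [h] with x ⟨n, hn⟩
    exact Set.mem_iUnion.2 ⟨n + 1, n, by simp, hn⟩
  have hlim := tendsto_setIntegral_of_monotone₀ (μ := μ) (f := g) (s := s) (fun N => ?_) ?_
    hg.integrableOn
  · rw [setIntegral_congr_set hU, setIntegral_univ] at hlim
    exact ge_of_tendsto' hlim fun N => setIntegral_nonneg_of_abelSum_pos hT hg _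
  · have : s N = ⋃ n ∈ Finset.range N, {x | 0 < abelSum T g (abelRate n) x} := by
      ext x; simp [hs]
    rw [this]
    exact .biUnion (Finset.range N).countable_toSet fun n _ =>
      nullMeasurableSet_lt aemeasurable_const
        (integrable_abelSum hT hg (abelRate_nonneg n) (abelRate_lt_one n)).1.aemeasurable
  · rintro N N' hNN x ⟨n, hn, h⟩
    exact ⟨n, Finset.range_mono hNN hn, h⟩

lemma ae_bddAbove_abelSum {g : X → ℝ} (hT : MeasurePreserving T μ μ) (hg : Integrable g μ)
    (h : ∀ A, MeasurableSet A → T ⁻¹' A = A → 0 ≤ ∫ x in A, g x ∂μ → μ A = 0) :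
    ∀ᵐ x ∂μ, BddAbove (Set.range fun n => abelSum T g (abelRate n) x) := by
  set D := {x | ¬ BddAbove (Set.range fun n => abelSum T g (abelRate n) x)} with hD
  have hDm : NullMeasurableSet D μ := by
    have : Dᶜ = ⋃ C : ℕ, ⋂ n, {x | abelSum T g (abelRate n) x ≤ C} := by
      ext x
      simp only [hD, Set.mem_compl_iff, Set.mem_ofPred_eq, not_not, Set.mem_iUnion, Set.mem_iInter]
      constructor
      · rintro ⟨C, hC⟩
        obtain ⟨k, hk⟩ := exists_nat_ge C
        exact ⟨k, fun n => (hC ⟨n, rfl⟩).trans hk⟩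
      · rintro ⟨C, hC⟩
        exact ⟨C, by rintro _ ⟨n, rfl⟩; exact hC n⟩
    rw [← NullMeasurableSet.compl_iff, this]
    exact .iUnion fun C => .iInter fun n => nullMeasurableSet_le
      (integrable_abelSum hT hg (abelRate_nonneg n) (abelRate_lt_one n)).1.aemeasurable
      aemeasurable_const
  have hDT : T ⁻¹' D =ᵐ[μ] D := by
    filter_upwards [ae_abelSummable hT hg] with x hx
    have hrec (n : ℕ) := abelSum_eq_add (hx _ (abelRate_nonneg n) (abelRate_lt_one n))
    simp only [smul_eq_mul] at hrec
    refine propext (not_congr ⟨?_, ?_⟩)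
    · rintro ⟨C, hC⟩
      refine ⟨g x + max C 0, ?_⟩
      rintro _ ⟨n, rfl⟩
      have h1 : abelSum T g (abelRate n) (T x) ≤ max C 0 := (hC ⟨n, rfl⟩).trans (le_max_left _ _)
      have h2 := mul_le_mul_of_nonneg_left h1 (abelRate_nonneg n)
      have h3 := mul_le_mul_of_nonneg_right (abelRate_lt_one n).le (le_max_right C 0)
      simp only [hrec n]
      linarith
    · rintro ⟨C, hC⟩
      refine ⟨2 * max (C - g x) 0, ?_⟩
      rintro _ ⟨n, rfl⟩
      have h1 : abelSum T g (abelRate n) x ≤ C := hC ⟨n, rfl⟩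
      rw [hrec n] at h1
      have h2 := le_max_left (C - g x) 0
      have h3 := le_max_right (C - g x) 0
      have h4 := half_le_abelRate n
      simp only
      by_contra! h5
      nlinarith
  obtain ⟨A, hA, hAD, hTA⟩ :=
    hT.quasiMeasurePreserving.exists_preimage_eq_of_preimage_ae hDm hDT
  have hTA' : MeasurePreserving T (μ.restrict A) (μ.restrict A) := by
    have := hT.restrict_preimage hA
    rwa [hTA] at this
  have hnn : 0 ≤ ∫ x in A, g x ∂μ := by
    refine integral_nonneg_of_ae_exists_abelSum_pos hTA' hg.restrict ?_
    rw [Measure.restrict_congr_set hAD, ae_restrict_iff'₀ hDm]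
    refine Eventually.of_forall fun x hx => ?_
    by_contra! h'
    exact hx ⟨0, by rintro _ ⟨n, rfl⟩; exact h' n⟩
  rw [ae_iff, ← measure_congr hAD]
  exact h A hA hTA hnn

lemma ae_eventually_abelMean_lt [IsFiniteMeasure μ] {f h : X → ℝ} (hT : MeasurePreserving T μ μ)
    (hf : Integrable f μ) (hh : Integrable h μ) (hhT : ∀ x, h (T x) = h x)
    (hfh : ∀ A, MeasurableSet A → T ⁻¹' A = A → ∫ x in A, f x ∂μ = ∫ x in A, h x ∂μ)
    {ε : ℝ} (hε : 0 < ε) :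
    ∀ᵐ x ∂μ, ∀ᶠ n in atTop, (1 - abelRate n) * abelSum T f (abelRate n) x < h x + ε := by
  have hhε : Integrable (fun x => h x + ε / 2) μ := hh.add (integrable_const _)
  have hb := ae_bddAbove_abelSum (g := fun x => f x - (h x + ε / 2)) hT (hf.sub hhε) ?_
  · filter_upwards [hb, ae_abelSummable hT hf] with x ⟨C, hC⟩ hx
    have hlim : Tendsto (fun n => (1 - abelRate n) * C) atTop (𝓝 0) := by
      simpa using tendsto_one_sub_abelRate.mul_const C
    filter_upwards [hlim.eventually_lt_const (half_pos hε)] with n hn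
    have h1 : abelSum T (fun x => f x - (h x + ε / 2)) (abelRate n) x ≤ C := hC ⟨n, rfl⟩
    rw [hx.abelSum_sub_const (fun y => by rw [hhT]) (abelRate_nonneg n) (abelRate_lt_one n)] at h1
    have hpos : 0 < 1 - abelRate n := sub_pos.2 (abelRate_lt_one n)
    have h2 := mul_le_mul_of_nonneg_left h1 hpos.le
    rw [mul_sub, mul_inv_cancel_left₀ hpos.ne'] at h2
    linarith
  · intro A hA hTA hnn
    rw [integral_sub hf.integrableOn hhε.integrableOn,
      integral_add hh.integrableOn (integrable_const _), hfh A hA hTA, setIntegral_const,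
      smul_eq_mul] at hnn
    have : μ.real A = 0 := by
      have := measureReal_nonneg (μ := μ) (s := A)
      nlinarith
    exact (measureReal_eq_zero_iff).1 this

lemma ae_tendsto_abelMean_abelRate [IsFiniteMeasure μ] {f h : X → ℝ}
    (hT : MeasurePreserving T μ μ)
    (hf : Integrable f μ) (hh : Integrable h μ) (hhT : ∀ x, h (T x) = h x)
    (hfh : ∀ A, MeasurableSet A → T ⁻¹' A = A → ∫ x in A, f x ∂μ = ∫ x in A, h x ∂μ) :
    ∀ᵐ x ∂μ, Tendsto (fun n => (1 - abelRate n) * abelSum T f (abelRate n) x) atTop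
      (𝓝 (h x)) := by
  have hup (m : ℕ) := ae_eventually_abelMean_lt hT hf hh hhT hfh (ε := ((m : ℝ) + 1)⁻¹)
    (by positivity)
  have hlo (m : ℕ) := ae_eventually_abelMean_lt (f := fun x => - f x) (h := fun x => - h x)
    hT hf.neg hh.neg (fun x => by rw [hhT])
    (fun A hA hTA => by rw [integral_neg, integral_neg, hfh A hA hTA]) (ε := ((m : ℝ) + 1)⁻¹)
    (by positivity)
  filter_upwards [ae_all_iff.2 hup, ae_all_iff.2 hlo] with x h1 h2
  have hneg (lam : ℝ) : abelSum T (fun x => - f x) lam x = - abelSum T f lam x := by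
    simp [abelSum, tsum_neg]
  refine tendsto_order.2 ⟨fun a ha => ?_, fun a ha => ?_⟩
  · obtain ⟨m, hm⟩ := exists_nat_one_div_lt (sub_pos.2 ha)
    rw [one_div] at hm
    filter_upwards [h2 m] with n hn
    rw [hneg] at hn
    linarith
  · obtain ⟨m, hm⟩ := exists_nat_one_div_lt (sub_pos.2 ha)
    rw [one_div] at hm
    filter_upwards [h1 m] with n hn
    linarith

/-- Scheffé's lemma. -/
lemma tendsto_integral_abs_sub_of_nonneg {ι : Type*} {l : Filter ι} [l.IsCountablyGenerated]
    {F : ι → X → ℝ} {h : X → ℝ} (hh : Integrable h μ)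
    (hF : ∀ᶠ i in l, Integrable (F i) μ ∧ (∀ᵐ x ∂μ, 0 ≤ F i x) ∧ ∫ x, F i x ∂μ = ∫ x, h x ∂μ)
    (hlim : ∀ᵐ x ∂μ, Tendsto (fun i => F i x) l (𝓝 (h x))) :
    Tendsto (fun i => ∫ x, |F i x - h x| ∂μ) l (𝓝 0) := by
  have hdom : Tendsto (fun i => ∫ x, max (h x - F i x) 0 ∂μ) l (𝓝 (∫ _, (0 : ℝ) ∂μ)) := by
    refine tendsto_integral_filter_of_dominated_convergence (fun x => |h x|) ?_ ?_ hh.abs ?_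
    · filter_upwards [hF] with i hi using (hh.sub hi.1).pos_part.1
    · filter_upwards [hF] with i hi
      filter_upwards [hi.2.1] with x hx
      rw [Real.norm_of_nonneg (le_max_right _ _)]
      exact max_le (by linarith [le_abs_self (h x)]) (abs_nonneg _)
    · filter_upwards [hlim] with x hx
      simpa using ((tendsto_const_nhds (x := h x)).sub hx).max (tendsto_const_nhds (x := (0 : ℝ)))
  have h2 := hdom.const_mul 2
  rw [integral_zero, mul_zero] at h2
  refine h2.congr' ?_
  filter_upwards [hF] with i hi
  have habs (x : X) : |F i x - h x| = 2 * max (h x - F i x) 0 + (F i x - h x) := by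
    rcases le_total (F i x) (h x) with h | h
    · rw [abs_of_nonpos (by linarith), max_eq_left (by linarith)]; ring
    · rw [abs_of_nonneg (by linarith), max_eq_right (by linarith)]; ring
  simp only [habs]
  have hpos : Integrable (fun x => max (h x - F i x) 0) μ := (hh.sub hi.1).pos_part
  have hsub : Integrable (fun x => F i x - h x) μ := hi.1.sub hh
  rw [integral_add (hpos.const_mul 2) hsub, integral_const_mul,
    integral_sub hi.1 hh, hi.2.2, sub_self, add_zero]

/-- `h` is the limit of the Abel means of `f` under `T`, almost everywhere and in `L¹`, and is an
invariant function with the same integrals as `f` over invariant sets. -/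
structure IsAbelLimit (μ : Measure X) (T : X → X) (f h : X → E) : Prop where
  integrable_left : Integrable f μ
  integrable : Integrable h μ
  ae_tendsto : ∀ᵐ x ∂μ, Tendsto (fun lam : ℝ => (1 - lam) • abelSum T f lam x) (𝓝[<] 1) (𝓝 (h x))
  ae_invariant : ∀ᵐ x ∂μ, h (T x) = h x
  setIntegral_eq : ∀ A, MeasurableSet A → T ⁻¹' A = A → ∫ x in A, f x ∂μ = ∫ x in A, h x ∂μ
  tendsto_integral : Tendsto (fun lam : ℝ => ∫ x, ‖(1 - lam) • abelSum T f lam x - h x‖ ∂μ)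
    (𝓝[<] 1) (𝓝 0)

lemma isAbelLimit_condExp_of_nonneg [IsFiniteMeasure μ] (hT : MeasurePreserving T μ μ)
    {f : X → ℝ} (hf : Integrable f μ) (hf0 : ∀ x, 0 ≤ f x) :
    IsAbelLimit μ T f (μ[f | MeasurableSpace.invariants T]) := by
  have hle := MeasurableSpace.invariants_le T
  have hinv (x : X) : (μ[f | MeasurableSpace.invariants T]) (T x)
      = (μ[f | MeasurableSpace.invariants T]) x :=
    congrFun (MeasurableSpace.comp_eq_of_measurable_invariants
      stronglyMeasurable_condExp.measurable) x
  have hset (A : Set X) (hA : MeasurableSet A) (hTA : T ⁻¹' A = A) :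
      ∫ x in A, f x ∂μ = ∫ x in A, (μ[f | MeasurableSpace.invariants T]) x ∂μ :=
    (setIntegral_condExp hle hf ⟨hA, hTA⟩).symm
  have hlim : ∀ᵐ x ∂μ, Tendsto (fun lam : ℝ => (1 - lam) • abelSum T f lam x) (𝓝[<] 1)
      (𝓝 ((μ[f | MeasurableSpace.invariants T]) x)) := by
    filter_upwards [ae_abelSummable hT hf,
      ae_tendsto_abelMean_abelRate hT hf integrable_condExp hinv hset] with x hx h
    exact hx.tendsto_abelMean hf0 h
  refine ⟨hf, integrable_condExp, hlim, .of_forall hinv, hset,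
    tendsto_integral_abs_sub_of_nonneg integrable_condExp ?_ hlim⟩
  filter_upwards [eventually_mem_Ico_nhdsLT_one] with lam hlam
  have hpos : 0 < 1 - lam := sub_pos.2 hlam.2
  refine ⟨(integrable_abelSum hT hf hlam.1 hlam.2).smul (1 - lam),
    .of_forall fun x => mul_nonneg hpos.le (abelSum_nonneg hf0 hlam.1 x), ?_⟩
  simp only [smul_eq_mul]
  rw [integral_const_mul, integral_abelSum hT hf hlam.1 hlam.2, mul_inv_cancel_left₀ hpos.ne',
    integral_condExp hle]

lemma IsAbelLimit.zero : IsAbelLimit μ T (fun _ => (0 : E)) (fun _ => 0) :=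
  ⟨integrable_zero _ _ _, integrable_zero _ _ _, by simp [abelSum], by simp, by simp,
    by simp [abelSum]⟩

lemma IsAbelLimit.comp [CompleteSpace E] {F : Type*} [NormedAddCommGroup F] [NormedSpace ℝ F]
    [CompleteSpace F] (hT : MeasurePreserving T μ μ) {f h : X → E} (H : IsAbelLimit μ T f h)
    (L : E →L[ℝ] F) : IsAbelLimit μ T (fun x => L (f x)) (fun x => L (h x)) where
  integrable_left := L.integrable_comp H.integrable_left
  integrable := L.integrable_comp H.integrable
  ae_tendsto := by
    filter_upwards [H.ae_tendsto, ae_abelSummable hT H.integrable_left] with x hx hs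
    refine ((L.continuous.tendsto _).comp hx).congr' ?_
    filter_upwards [eventually_mem_Ico_nhdsLT_one] with lam hlam
    simp [hs.abelSum_comp L hlam.1 hlam.2]
  ae_invariant := H.ae_invariant.mono fun x hx => by rw [hx]
  setIntegral_eq A hA hTA := by
    rw [L.integral_comp_comm H.integrable_left.integrableOn,
      L.integral_comp_comm H.integrable.integrableOn, H.setIntegral_eq A hA hTA]
  tendsto_integral := by
    have hlim := H.tendsto_integral.const_mul ‖L‖
    rw [mul_zero] at hlim
    refine squeeze_zero' (.of_forall fun _ => integral_nonneg fun _ => norm_nonneg _) ?_ hlim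
    filter_upwards [eventually_mem_Ico_nhdsLT_one] with lam hlam
    rw [← integral_const_mul]
    refine integral_mono_of_nonneg (.of_forall fun _ => norm_nonneg _)
      ((((integrable_abelSum hT H.integrable_left hlam.1 hlam.2).smul _).sub
        H.integrable).norm.const_mul _) ?_
    filter_upwards [ae_abelSummable hT H.integrable_left] with x hs
    rw [hs.abelSum_comp L hlam.1 hlam.2, ← map_smul, ← map_sub]
    exact L.le_opNorm _

lemma IsAbelLimit.add [CompleteSpace E] (hT : MeasurePreserving T μ μ) {f₁ f₂ h₁ h₂ : X → E}
    (H₁ : IsAbelLimit μ T f₁ h₁) (H₂ : IsAbelLimit μ T f₂ h₂) :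
    IsAbelLimit μ T (fun x => f₁ x + f₂ x) (fun x => h₁ x + h₂ x) where
  integrable_left := H₁.integrable_left.add H₂.integrable_left
  integrable := H₁.integrable.add H₂.integrable
  ae_tendsto := by
    filter_upwards [H₁.ae_tendsto, H₂.ae_tendsto, ae_abelSummable hT H₁.integrable_left,
      ae_abelSummable hT H₂.integrable_left] with x h₁ h₂ hs₁ hs₂
    refine (h₁.add h₂).congr' ?_
    filter_upwards [eventually_mem_Ico_nhdsLT_one] with lam hlam
    rw [hs₁.abelSum_add hs₂ hlam.1 hlam.2, smul_add]
  ae_invariant := by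
    filter_upwards [H₁.ae_invariant, H₂.ae_invariant] with x h₁ h₂
    rw [h₁, h₂]
  setIntegral_eq A hA hTA := by
    rw [integral_add H₁.integrable_left.integrableOn H₂.integrable_left.integrableOn,
      integral_add H₁.integrable.integrableOn H₂.integrable.integrableOn,
      H₁.setIntegral_eq A hA hTA, H₂.setIntegral_eq A hA hTA]
  tendsto_integral := by
    have hlim := H₁.tendsto_integral.add H₂.tendsto_integral
    rw [add_zero] at hlim
    refine squeeze_zero' (.of_forall fun _ => integral_nonneg fun _ => norm_nonneg _) ?_ hlim
    filter_upwards [eventually_mem_Ico_nhdsLT_one] with lam hlam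
    have hi₁ : Integrable (fun x => ‖(1 - lam) • abelSum T f₁ lam x - h₁ x‖) μ :=
      (((integrable_abelSum hT H₁.integrable_left hlam.1 hlam.2).smul (1 - lam)).sub
        H₁.integrable).norm
    have hi₂ : Integrable (fun x => ‖(1 - lam) • abelSum T f₂ lam x - h₂ x‖) μ :=
      (((integrable_abelSum hT H₂.integrable_left hlam.1 hlam.2).smul (1 - lam)).sub
        H₂.integrable).norm
    rw [← integral_add hi₁ hi₂]
    refine integral_mono_of_nonneg (.of_forall fun _ => norm_nonneg _) (hi₁.add hi₂) ?_
    filter_upwards [ae_abelSummable hT H₁.integrable_left,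
      ae_abelSummable hT H₂.integrable_left] with x hs₁ hs₂
    rw [hs₁.abelSum_add hs₂ hlam.1 hlam.2, smul_add, add_sub_add_comm]
    exact norm_add_le _ _

lemma IsAbelLimit.sum [CompleteSpace E] (hT : MeasurePreserving T μ μ) {ι : Type*}
    (s : Finset ι) {f h : ι → X → E} (H : ∀ i, IsAbelLimit μ T (f i) (h i)) :
    IsAbelLimit μ T (fun x => ∑ i ∈ s, f i x) (fun x => ∑ i ∈ s, h i x) := by
  classical
  induction s using Finset.induction_on with
  | empty => simpa using IsAbelLimit.zero
  | insert a s ha ih => simpa only [Finset.sum_insert ha] using (H a).add hT ih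

lemma exists_isAbelLimit_real [IsFiniteMeasure μ] (hT : MeasurePreserving T μ μ) {f : X → ℝ}
    (hf : Integrable f μ) : ∃ h, IsAbelLimit μ T f h := by
  have hpos := isAbelLimit_condExp_of_nonneg hT hf.pos_part fun x => le_max_right _ _
  have hneg := isAbelLimit_condExp_of_nonneg hT hf.neg_part fun x => le_max_right _ _
  have H := hpos.add hT (hneg.comp hT (-ContinuousLinearMap.id ℝ ℝ))
  refine ⟨_, (congrArg (IsAbelLimit μ T · _) (funext fun x => ?_)).mp H⟩
  simp only [neg_apply, ContinuousLinearMap.id_apply]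
  rcases le_total (f x) 0 with h | h
  · rw [max_eq_right h, max_eq_left (by linarith)]; ring
  · rw [max_eq_left h, max_eq_right (by linarith)]; ring

lemma exists_isAbelLimit [FiniteDimensional ℝ E] [IsFiniteMeasure μ]
    (hT : MeasurePreserving T μ μ) {f : X → E} (hf : Integrable f μ) :
    ∃ h, IsAbelLimit μ T f h := by
  have := FiniteDimensional.complete ℝ E
  let b := Module.finBasis ℝ E
  have hcoord (i) : ∃ h, IsAbelLimit μ T (fun x => b.coord i (f x)) h :=
    exists_isAbelLimit_real hT ((b.coord i).toContinuousLinearMap.integrable_comp hf)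
  choose h hh using hcoord
  have H := IsAbelLimit.sum hT Finset.univ
    fun i => (hh i).comp hT ((ContinuousLinearMap.id ℝ ℝ).smulRight (b i))
  refine ⟨_, (congrArg (IsAbelLimit μ T · _) (funext fun x => ?_)).mp H⟩
  simp

end AbelMean

theorem stmt16 {l : ℕ} {X : Type*} [MeasurableSpace X]
    (μ : Measure X) [IsProbabilityMeasure μ]
    (T : X → X) (hT : MeasurePreserving T μ μ)
    (f : X → EuclideanSpace ℝ (Fin l)) (hf : Integrable f μ) :
    ∃ h : X → EuclideanSpace ℝ (Fin l),
      Integrable h μ ∧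
      (∀ᵐ x ∂μ, Tendsto (fun lam : ℝ => (1 - lam) • ∑' j : ℕ, lam ^ j • f (T^[j] x))
        (𝓝[<] (1 : ℝ)) (𝓝 (h x))) ∧
      (∀ᵐ x ∂μ, h (T x) = h x) ∧
      (∀ A : Set X, MeasurableSet A → T ⁻¹' A = A →
        ∫ x in A, f x ∂μ = ∫ x in A, h x ∂μ) ∧
      Tendsto (fun lam : ℝ =>
          ∫ x, ‖(1 - lam) • ∑' j : ℕ, lam ^ j • f (T^[j] x) - h x‖ ∂μ)
        (𝓝[<] (1 : ℝ)) (𝓝 0) := by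
  obtain ⟨h, H⟩ := exists_isAbelLimit hT hf
  exact ⟨h, H.integrable, H.ae_tendsto, H.ae_invariant, H.setIntegral_eq, H.tendsto_integral⟩
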